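/- arXiv:1909.06551 — 3 statements merged into one kernel-verified Lean document; each statement's English description precedes it below -/
import Mathlib

section
/- Let V be a real vector space with a symmetric bilinear form g, let ξ ∈ V satisfy g(ξ,ξ) = −1, let η(X) = g(X,ξ), let κ be a real number, let n ≥ 3 be a natural number, and set λ = n(n−1)κ. Define R(X,Y)Z = κ·(g(Y,Z)X − g(X,Z)Y), S(X,Y) = (n−1)κ·g(X,Y), and Q(X) = (n−1)κ·X. Then the conharmonic curvature tensor H(X,Y)Z = R(X,Y)Z − (1/(n−2))·(g(Y,Z)Q(X) − g(X,Z)Q(Y) + S(Y,Z)X − S(X,Z)Y) satisfies H(X,Y)ξ = −(λ/((n−1)(n−2)))·(η(Y)X − η(X)Y) for all X, Y ∈ V. Moreover, if there exists X ∈ V that is not a scalar multiple of ξ, then H(X,Y)ξ = 0 for all X, Y ∈ V if and only if λ = 0. (This is Proposition 3.12: an (LCS)_n-manifold admitting a Yamabe soliton (g, ξ) is ξ-conharmonically flat if and only if the soliton is steady.) -/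
/-- Proposition 3.12: an (LCS)_n-manifold admitting a Yamabe soliton (g, ξ) has
H(X,Y)ξ = −(λ/((n−1)(n−2)))(η(Y)X − η(X)Y), and is ξ-conharmonically flat iff
the soliton is steady (λ = 0). -/
theorem xi_conharmonically_flat_iff_steady
    {V : Type*} [AddCommGroup V] [Module ℝ V]
    (g : LinearMap.BilinForm ℝ V) (hg : ∀ X Y : V, g X Y = g Y X)
    (ξ : V) (hξ : g ξ ξ = -1)
    (η : V → ℝ) (hη : ∀ X : V, η X = g X ξ)
    (κ : ℝ) (n : ℕ) (hn : 3 ≤ n)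
    (lam : ℝ) (hlam : lam = (n : ℝ) * ((n : ℝ) - 1) * κ)
    (R : V → V → V → V)
    (hR : ∀ X Y Z : V, R X Y Z = κ • (g Y Z • X - g X Z • Y))
    (S : V → V → ℝ)
    (hS : ∀ X Y : V, S X Y = ((n : ℝ) - 1) * κ * g X Y)
    (Q : V → V) (hQ : ∀ X : V, Q X = (((n : ℝ) - 1) * κ) • X)
    (H : V → V → V → V)
    (hH : ∀ X Y Z : V,
      H X Y Z = R X Y Z - (1 / ((n : ℝ) - 2)) •
        (g Y Z • Q X - g X Z • Q Y + S Y Z • X - S X Z • Y)) :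
    (∀ X Y : V,
      H X Y ξ = (-(lam / (((n : ℝ) - 1) * ((n : ℝ) - 2)))) • (η Y • X - η X • Y)) ∧
    ((∃ X : V, ∀ c : ℝ, X ≠ c • ξ) →
      ((∀ X Y : V, H X Y ξ = 0) ↔ lam = 0)) := by
  have hn' : (3 : ℝ) ≤ n := by exact_mod_cast hn
  have h₁ : (n : ℝ) - 1 ≠ 0 := by linarith
  have h₂ : (n : ℝ) - 2 ≠ 0 := by linarith
  have key : ∀ X Y : V,
      H X Y ξ = (-(lam / (((n : ℝ) - 1) * ((n : ℝ) - 2)))) • (η Y • X - η X • Y) := by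
    intro X Y
    rw [hH, hR, hS, hS, hQ, hQ, hη, hη, hlam]
    match_scalars <;> field_simp <;> ring
  refine ⟨key, ?_⟩
  rintro ⟨X, hX⟩
  constructor
  · intro hflat
    have h := hflat X ξ
    rw [key, smul_eq_zero] at h
    rcases h with h | h
    · simpa [h₁, h₂] using h
    · rw [hη ξ, hξ, sub_eq_zero, neg_one_smul, neg_eq_iff_eq_neg, ← neg_smul] at h
      exact absurd h (hX _)
  · intro hzero X Y
    simp [key, hzero]
end

section
/- Let V be a real vector space with a symmetric bilinear form g, let ξ ∈ V satisfy g(ξ,ξ) = −1, let η(X) = g(X,ξ), let κ and λ be real numbers and n ≥ 2 a natural number. Define R(X,Y)Z = κ·(g(Y,Z)X − g(X,Z)Y) and S(X,Y) = (λ/n)·g(X,Y). Suppose that for all X, Y, Z, W ∈ V: S(X,R(Y,Z)W)ξ − S(ξ,R(Y,Z)W)X + S(X,Y)R(ξ,Z)W − S(ξ,Y)R(X,Z)W + S(X,Z)R(Y,ξ)W − S(ξ,Z)R(Y,X)W + S(X,W)R(Y,Z)ξ − S(ξ,W)R(Y,Z)X = 0. Then λ·κ·(g(X,Y) + η(X)η(Y))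 = 0 for all X, Y ∈ V. (This is the key intermediate identity (4.4)–(4.5) in the proof of Theorem 4.2: the condition S(ξ,X)·R = 0 on an (LCS)_n-manifold admitting a Yamabe soliton forces (λ/n)(α²−ρ)g(φX,φY) = 0.) -/
/-- Key intermediate identity (4.4)–(4.5) in the proof of Theorem 4.2: the
condition S(ξ,X)·R = 0 on an (LCS)_n-manifold admitting a Yamabe soliton forces
(λ/n)(α²−ρ)g(φX,φY) = 0, i.e. λκ(g(X,Y) + η(X)η(Y)) = 0. -/
theorem S_xi_R_zero_key_identity
    {V : Type*} [AddCommGroup V] [Module ℝ V]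
    (g : LinearMap.BilinForm ℝ V) (hg : ∀ X Y : V, g X Y = g Y X)
    (ξ : V) (hξ : g ξ ξ = -1)
    (η : V → ℝ) (hη : ∀ X : V, η X = g X ξ)
    (κ lam : ℝ) (n : ℕ) (hn : 2 ≤ n)
    (R : V → V → V → V)
    (hR : ∀ X Y Z : V, R X Y Z = κ • (g Y Z • X - g X Z • Y))
    (S : V → V → ℝ) (hS : ∀ X Y : V, S X Y = (lam / (n : ℝ)) * g X Y)
    (hcond : ∀ X Y Z W : V,
      S X (R Y Z W) • ξ - S ξ (R Y Z W) • X
      + S X Y • R ξ Z W - S ξ Y • R X Z W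
      + S X Z • R Y ξ W - S ξ Z • R Y X W
      + S X W • R Y Z ξ - S ξ W • R Y Z X = 0) :
    ∀ X Y : V, lam * κ * (g X Y + η X * η Y) = 0 := by
  intro X Y
  have hn0 : (n : ℝ) ≠ 0 := by
    have : n ≠ 0 := by omega
    exact_mod_cast this
  have h := congrArg (fun v => g v ξ) (hcond X Y ξ ξ)
  simp only [hR, hS, map_add, map_sub, map_smul, LinearMap.add_apply, LinearMap.sub_apply,
    LinearMap.smul_apply, smul_eq_mul, hξ, hg ξ X, hg ξ Y, map_zero,
    LinearMap.zero_apply] at h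
  rw [hη, hη]
  field_simp at h
  rw [hg Y X] at h
  linarith
end

section
/- Let V be a real vector space with a symmetric bilinear form g, let ξ ∈ V satisfy g(ξ,ξ) = −1, let η(X) = g(X,ξ), let κ be a real number, let n ≥ 2 be a natural number, and set λ = n(n−1)κ. Define R(X,Y)Z = κ·(g(Y,Z)X − g(X,Z)Y) and S(X,Y) = (λ/n)·g(X,Y). Suppose there exist X₀, Y₀ ∈ V with g(X₀,Y₀) + η(X₀)η(Y₀) ≠ 0, and suppose that for all X, Y, Z, W ∈ V: S(X,R(Y,Z)W)ξ − S(ξ,R(Y,Z)W)X + S(X,Y)R(ξ,Z)W − S(ξ,Y)R(X,Z)W + S(X,Z)R(Y,ξ)W − S(ξ,Z)R(Y,X)W + S(X,W)R(Y,Z)ξ − S(ξ,W)R(Y,Z)X = 0. Then λ = 0 and κ = 0. (This is Theorem 4.2: if an (LCS)_n-manifold admitting a Yamabe soliton (g, ξ) satisfies S(ξ,X)·R = 0, then the manifold is flat and the soliton is steady.) -/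
/-- Theorem 4.2: if an (LCS)_n-manifold admitting a Yamabe soliton (g, ξ)
satisfies S(ξ,X)·R = 0, then the manifold is flat (κ = 0) and the soliton is
steady (λ = 0). -/
theorem S_xi_R_zero_implies_flat_and_steady
    {V : Type*} [AddCommGroup V] [Module ℝ V]
    (g : LinearMap.BilinForm ℝ V) (hg : ∀ X Y : V, g X Y = g Y X)
    (ξ : V) (hξ : g ξ ξ = -1)
    (η : V → ℝ) (hη : ∀ X : V, η X = g X ξ)
    (κ : ℝ) (n : ℕ) (hn : 2 ≤ n)
    (lam : ℝ) (hlam : lam = (n : ℝ) * ((n : ℝ) - 1) * κ)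
    (R : V → V → V → V)
    (hR : ∀ X Y Z : V, R X Y Z = κ • (g Y Z • X - g X Z • Y))
    (S : V → V → ℝ) (hS : ∀ X Y : V, S X Y = (lam / (n : ℝ)) * g X Y)
    (hnondeg : ∃ X₀ Y₀ : V, g X₀ Y₀ + η X₀ * η Y₀ ≠ 0)
    (hcond : ∀ X Y Z W : V,
      S X (R Y Z W) • ξ - S ξ (R Y Z W) • X
      + S X Y • R ξ Z W - S ξ Y • R X Z W
      + S X Z • R Y ξ W - S ξ Z • R Y X W
      + S X W • R Y Z ξ - S ξ W • R Y Z X = 0) :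
    lam = 0 ∧ κ = 0 := by
  have hn2 : (2 : ℝ) ≤ n := by exact_mod_cast hn
  have hn0 : (n : ℝ) ≠ 0 := by linarith
  have hn1 : (n : ℝ) - 1 ≠ 0 := by linarith
  obtain ⟨X, Y, hXY⟩ := hnondeg
  rw [hη, hη] at hXY
  have hdiv : lam / n = ((n : ℝ) - 1) * κ := by
    rw [hlam]
    field_simp
  have h := congrArg (fun v => g v ξ) (hcond X Y ξ ξ)
  simp only [hS, hR, hdiv, map_add, map_sub, map_smul, LinearMap.add_apply,
    LinearMap.sub_apply, LinearMap.smul_apply, smul_eq_mul, map_zero,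
    LinearMap.zero_apply, hξ, hg ξ X, hg ξ Y, hg Y X] at h
  have hprod : ((n : ℝ) - 1) * κ ^ 2 * (g X Y + g X ξ * g Y ξ) = 0 := by
    linear_combination h / 2
  have hκ : κ = 0 := by simpa [hn1, hXY] using hprod
  exact ⟨by rw [hlam, hκ, mul_zero], hκ⟩
end
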